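/- Let C be a set of permutations that is closed under pattern containment (if σ ∈ C and π occurs as a pattern in σ then π ∈ C) and has at most exponential growth: there exists a real constant c ≥ 1 such that for every k, the number of permutations of length k in C is at most c^k. Then for every ε > 0 there exists N such that for every n ≥ N there exists a permutation σ of length n with the property that every permutation of C occurring as a pattern in σ has length less than n^{1/2+ε}. -/

import Mathlib

/-- `π` occurs as a pattern in `σ`. -/
def Pattern {k n : ℕ} (π : Equiv.Perm (Fin k)) (σ : Equiv.Perm (Fin n)) : Prop :=
  ∃ f : Fin k → Fin n, StrictMono f ∧ ∀ ℓ m : Fin k, π ℓ < π m ↔ σ (f ℓ) < σ (f m)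

/-- The permutation 2 4 1 3 (one-line notation; zero-indexed values 1 3 0 2). -/
def perm2413 : Equiv.Perm (Fin 4) := c[0, 1, 3, 2]

/-- The permutation 3 1 4 2 (one-line notation; zero-indexed values 2 0 3 1). -/
def perm3142 : Equiv.Perm (Fin 4) := c[0, 2, 3, 1]

/-- A permutation is separable if it avoids both 2413 and 3142. -/
def Separable {n : ℕ} (σ : Equiv.Perm (Fin n)) : Prop :=
  ¬ Pattern perm2413 σ ∧ ¬ Pattern perm3142 σ

/-- Positive concatenation (direct sum) `π ⊕ π'`:
the word `π₁ ⋯ π_k (π'₁+k) ⋯ (π'_{k'}+k)`. -/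
def dsum {k k' : ℕ} (π : Equiv.Perm (Fin k)) (π' : Equiv.Perm (Fin k')) :
    Equiv.Perm (Fin (k + k')) :=
  finSumFinEquiv.symm.trans ((Equiv.sumCongr π π').trans finSumFinEquiv)

/-- Negative concatenation (skew sum) `π ⊖ π'`:
the word `(π₁+k') ⋯ (π_k+k') π'₁ ⋯ π'_{k'}`. -/
def ssum {k k' : ℕ} (π : Equiv.Perm (Fin k)) (π' : Equiv.Perm (Fin k')) :
    Equiv.Perm (Fin (k + k')) :=
  finSumFinEquiv.symm.trans ((Equiv.sumCongr π π').trans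
    ((Equiv.sumComm (Fin k) (Fin k')).trans (finSumFinEquiv.trans (finCongr (Nat.add_comm k' k)))))

/-- `π` has an occurrence in `σ` using the (1-indexed) interval `[i..j]` of indices and
`[a..b]` of values. -/
def OccursIn {k n : ℕ} (π : Equiv.Perm (Fin k)) (σ : Equiv.Perm (Fin n))
    (i j a b : ℕ) : Prop :=
  ∃ f : Fin k → Fin n, StrictMono f ∧
    (∀ ℓ m : Fin k, π ℓ < π m ↔ σ (f ℓ) < σ (f m)) ∧
    (∀ ℓ : Fin k, i ≤ (f ℓ : ℕ) + 1 ∧ (f ℓ : ℕ) + 1 ≤ j) ∧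
    (∀ ℓ : Fin k, a ≤ (σ (f ℓ) : ℕ) + 1 ∧ (σ (f ℓ) : ℕ) + 1 ≤ b)

/-- Two permutations with the same order pattern are equal. -/
theorem perm_eq_of_lt_iff {k : ℕ} (α β : Equiv.Perm (Fin k))
    (h : ∀ i j, α i < α j ↔ β i < β j) : α = β := by
  have hm : StrictMono (fun x => β (α.symm x)) := by
    intro x y hxy
    have := (h (α.symm x) (α.symm y)).1 (by simpa using hxy)
    exact this
  let e : Fin k ≃o Fin k := StrictMono.orderIsoOfSurjective _ hm
    (β.surjective.comp α.symm.surjective)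
  ext i
  have h1 : e = OrderIso.refl _ := Subsingleton.elim _ _
  have h2 : e (α i) = α i := by rw [h1]; rfl
  have h3 : e (α i) = β i := by
    change β (α.symm (α i)) = β i
    simp
  rw [← h2, h3]

/-- Standardization of an injective word. -/
theorem exists_standardization {k m : ℕ} (g : Fin k → Fin m) (hg : Function.Injective g) :
    ∃ ρ : Equiv.Perm (Fin k), ∀ i j, ρ i < ρ j ↔ g i < g j := by
  have hs : StrictMono (g ∘ Tuple.sort g) :=
    (Tuple.monotone_sort g).strictMono_of_injective (hg.comp (Tuple.sort g).injective)
  refine ⟨(Tuple.sort g).symm, fun i j => ?_⟩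
  rw [← hs.lt_iff_lt]
  simp

/-- A longer pattern in the class yields one of any smaller length. -/
theorem exists_shorter {k m n : ℕ} (hkm : k ≤ m) (π : Equiv.Perm (Fin m))
    (σ : Equiv.Perm (Fin n)) (h : Pattern π σ) :
    ∃ ρ : Equiv.Perm (Fin k), Pattern ρ π ∧ Pattern ρ σ := by
  obtain ⟨f, hf, hfσ⟩ := h
  obtain ⟨ρ, hρ⟩ := exists_standardization (fun i => π (Fin.castLE hkm i))
    (π.injective.comp (Fin.castLE_injective hkm))
  refine ⟨ρ, ⟨Fin.castLE hkm, Fin.strictMono_castLE hkm, hρ⟩,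
    ⟨f ∘ Fin.castLE hkm, hf.comp (Fin.strictMono_castLE hkm), fun i j => ?_⟩⟩
  rw [hρ]
  exact hfσ _ _

/-- Counting: if every permutation of length `n` contains a pattern in `P` then
`k! ≤ |P| * choose n k`. -/
theorem factorial_le_of_all {k n : ℕ} (P : Equiv.Perm (Fin k) → Prop)
    (h : ∀ σ : Equiv.Perm (Fin n), ∃ π, P π ∧ Pattern π σ) :
    k.factorial ≤ Nat.card {π // P π} * n.choose k := by
  classical
  choose p hp f hf hpf using h
  let F : Equiv.Perm (Fin n) × Equiv.Perm (Fin k) →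
      ({π // P π} × {s : Finset (Fin n) // s.card = k}) × Equiv.Perm (Fin n) :=
    fun x => ((⟨p x.1, hp x.1⟩, ⟨Finset.univ.image (f x.1), by
      rw [Finset.card_image_of_injective _ (hf x.1).injective]; simp⟩),
      (x.2.viaEmbedding ⟨f x.1, (hf x.1).injective⟩).trans x.1)
  have hF : Function.Injective F := by
    rintro ⟨σ, τ⟩ ⟨σ', τ'⟩ hh
    simp only [F, Prod.mk.injEq, Subtype.mk.injEq] at hh
    obtain ⟨⟨h1, h2⟩, h3⟩ := hh
    have hff : f σ = f σ' := by
      apply (StrictMono.range_inj (hf σ) (hf σ')).1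
      have := congrArg (fun s : Finset (Fin n) => (s : Set (Fin n))) h2
      simpa using this
    have key : ∀ i, σ (f σ (τ i)) = σ' (f σ' (τ' i)) := by
      intro i
      have := congrArg (fun e : Equiv.Perm (Fin n) => e (f σ i)) h3
      simp only [Equiv.trans_apply] at this
      have e1 := Equiv.Perm.viaEmbedding_apply τ ⟨f σ, (hf σ).injective⟩ i
      have e2 := Equiv.Perm.viaEmbedding_apply τ' ⟨f σ', (hf σ').injective⟩ i
      simp only [Function.Embedding.coeFn_mk] at e1 e2
      rw [e1] at this
      rw [this]
      conv_lhs => rw [hff]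
      rw [e2]
    have ht : τ.trans (p σ) = τ'.trans (p σ) := by
      apply perm_eq_of_lt_iff
      intro i j
      simp only [Equiv.trans_apply]
      rw [hpf σ, key, key, ← hpf σ', h1]
    have ht' : τ = τ' := by
      ext i
      have := congrArg (fun e : Equiv.Perm (Fin k) => e i) ht
      simp only [Equiv.trans_apply] at this
      rw [(p σ).injective this]
    subst ht'
    have hs : σ = σ' := by
      simp only [hff] at h3
      ext x
      have := congrArg (fun e : Equiv.Perm (Fin n) =>
        e ((τ.viaEmbedding ⟨f σ', (hf σ').injective⟩).symm x)) h3
      simp only [Equiv.trans_apply, Equiv.apply_symm_apply] at this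
      rw [this]
    rw [hs]
  have hcard := Nat.card_le_card_of_injective F hF
  rw [Nat.card_prod, Nat.card_prod, Nat.card_prod] at hcard
  have e1 : Nat.card {s : Finset (Fin n) // s.card = k} = n.choose k := by
    rw [Nat.card_eq_fintype_card, Fintype.card_finset_len, Fintype.card_fin]
  rw [e1, mul_comm] at hcard
  have e2 : Nat.card (Equiv.Perm (Fin k)) = k.factorial := by
    rw [Nat.card_perm, Nat.card_fin]
  rw [e2] at hcard
  exact Nat.le_of_mul_le_mul_right hcard Nat.card_pos

theorem sq_le_of_factorial {k n : ℕ} (hk : k ≠ 0) (c : ℝ) (hc : 1 ≤ c)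
    (h : (k.factorial : ℝ) ≤ c ^ k * n.choose k) :
    (k : ℝ) ^ 2 ≤ Real.exp 1 ^ 2 * c * n := by
  have h1 := Nat.choose_le_pow_div (α := ℝ) k n
  have hpos : (0 : ℝ) < k.factorial := by exact_mod_cast k.factorial_pos
  have h2 : (k : ℝ) ^ k / k.factorial ≤ Real.exp k :=
    Real.pow_div_factorial_le_exp _ (by positivity) k
  rw [div_le_iff₀ hpos] at h2
  have h3 : (k.factorial : ℝ) ^ 2 ≤ c ^ k * n ^ k := by
    have : (k.factorial : ℝ) ≤ c ^ k * (n ^ k / k.factorial) :=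
      h.trans (by gcongr)
    rw [← mul_div_assoc, le_div_iff₀ hpos] at this
    nlinarith
  have h4 : ((k : ℝ) ^ 2) ^ k ≤ (Real.exp 1 ^ 2 * c * n) ^ k := by
    have e : Real.exp k = Real.exp 1 ^ k := by rw [← Real.exp_nat_mul]; simp
    rw [e] at h2
    calc ((k : ℝ) ^ 2) ^ k = ((k : ℝ) ^ k) ^ 2 := by rw [← pow_mul, ← pow_mul, mul_comm]
      _ ≤ (Real.exp 1 ^ k * k.factorial) ^ 2 := by gcongr
      _ = (Real.exp 1 ^ 2) ^ k * (k.factorial : ℝ) ^ 2 := by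
        rw [mul_pow, ← pow_mul, ← pow_mul, mul_comm k 2]
      _ ≤ (Real.exp 1 ^ 2) ^ k * (c ^ k * n ^ k) := by gcongr
      _ = _ := by rw [mul_pow, mul_pow, mul_assoc]
  exact le_of_pow_le_pow_left₀ hk (by positivity) h4

/-- For a class `C` closed under pattern containment with at most exponential growth, for
every `ε > 0` and all sufficiently large `n` there is a permutation of length `n` all of whose
patterns from `C` have length less than `n^(1/2+ε)`. -/
theorem exists_perm_all_C_patterns_small
    (C : ∀ {m : ℕ}, Equiv.Perm (Fin m) → Prop)
    (hclosed : ∀ {m m' : ℕ} (π : Equiv.Perm (Fin m)) (τ : Equiv.Perm (Fin m')),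
      C τ → Pattern π τ → C π)
    (c : ℝ) (hc : 1 ≤ c)
    (hgrowth : ∀ m : ℕ, (Nat.card {π : Equiv.Perm (Fin m) // C π} : ℝ) ≤ c ^ m) :
    ∀ ε : ℝ, 0 < ε → ∃ N : ℕ, ∀ n ≥ N, ∃ σ : Equiv.Perm (Fin n),
      ∀ (m : ℕ) (π : Equiv.Perm (Fin m)), C π → Pattern π σ →
        (m : ℝ) < (n : ℝ) ^ ((1 : ℝ) / 2 + ε) := by
  intro ε hε
  have hlim : Filter.Tendsto (fun n : ℕ => (n : ℝ) ^ (2 * ε)) Filter.atTop Filter.atTop :=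
    (tendsto_rpow_atTop (by positivity)).comp tendsto_natCast_atTop_atTop
  obtain ⟨N, hN⟩ := Filter.eventually_atTop.1
    (hlim.eventually_gt_atTop (Real.exp 1 ^ 2 * c))
  refine ⟨max N 1, fun n hn => ?_⟩
  have hn1 : 0 < (n : ℝ) := by
    have : 1 ≤ n := le_trans (le_max_right _ _) hn
    exact_mod_cast this
  have hbig := hN n (le_trans (le_max_left _ _) hn)
  by_contra! hcon
  have hk0 : ⌈(n : ℝ) ^ ((1 : ℝ) / 2 + ε)⌉₊ ≠ 0 :=
    (Nat.ceil_pos.2 (Real.rpow_pos_of_pos hn1 _)).ne'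
  have hkge := Nat.le_ceil ((n : ℝ) ^ ((1 : ℝ) / 2 + ε))
  generalize hk : ⌈(n : ℝ) ^ ((1 : ℝ) / 2 + ε)⌉₊ = k at hk0 hkge
  have hall : ∀ σ : Equiv.Perm (Fin n), ∃ π : Equiv.Perm (Fin k), C π ∧ Pattern π σ := by
    intro σ
    obtain ⟨m, π, hCπ, hπσ, hm⟩ := hcon σ
    have hkm : k ≤ m := by rw [← hk]; exact Nat.ceil_le.2 hm
    obtain ⟨ρ, h1, h2⟩ := exists_shorter hkm π σ hπσ
    exact ⟨ρ, hclosed ρ π hCπ h1, h2⟩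
  have h1 := factorial_le_of_all (fun π : Equiv.Perm (Fin k) => C π) hall
  have h2 : (k.factorial : ℝ) ≤ c ^ k * n.choose k := by
    have : (k.factorial : ℝ) ≤
        (Nat.card {π : Equiv.Perm (Fin k) // C π} : ℝ) * n.choose k := by exact_mod_cast h1
    exact this.trans (by gcongr; exact hgrowth k)
  have h3 := sq_le_of_factorial hk0 c hc h2
  have h4 : ((n : ℝ) ^ ((1 : ℝ) / 2 + ε)) ^ 2 ≤ (k : ℝ) ^ 2 := by gcongr
  have h5 : ((n : ℝ) ^ ((1 : ℝ) / 2 + ε)) ^ 2 = (n : ℝ) ^ (2 * ε) * n := by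
    rw [← Real.rpow_natCast, ← Real.rpow_mul hn1.le, ← Real.rpow_add_one hn1.ne']
    congr 1
    push_cast
    ring
  have h6 : Real.exp 1 ^ 2 * c * n < (n : ℝ) ^ (2 * ε) * n := by gcongr
  linarith
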